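/- Factored second-order decomposition (Appendix B, Eq. tbar-eff cross term): let w : E → ℝ be such that the Laplacian L(w) is invertible, set Z = det L(w) and B = (L(w)^{-1})^⊤, and let L'_{(i',j'),(i,j)} = ∂L_{i'j'}/∂w_{ij}. Let r_{ij} ∈ ℝ^R and s_{ij} ∈ ℝ^S be fixed vectors indexed by edges, with totals r̄ = Σ_{(i,j)∈E} w̄_{ij}(w) r_{ij} and s̄ = Σ_{(i,j)∈E} w̄_{ij}(w) s_{ij}. Define, for j', l' ∈ {1,…,N}, r̂_{j'l'} = Σ_{(k,l)∈E} Σ_{k'=1}^{N} B_{k'j'} L'_{(k',l'),(k,l)} w_{kl} r_{kl} ∈ ℝ^R and ŝ_{j'l'} = Σ_{(i,j)∈E} Σ_{i'=1}^{N} B_{i'l'} L'_{(i',j'),(i,j)} w_{ij} s_{ij} ∈ ℝ^S. Then Σ_{(i,j)∈E} Σ_{(k,l)∈E} (∂²Z/∂w_{ij}∂w_{kl})(w) · w_{ij} w_{kl} · r_{ij} s_{kl}^⊤ = (1/Z) r̄ s̄^⊤ − Z Σ_{j',l'=1}^{N} r̂_{j'l'} ŝ_{j'l'}^⊤. -/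

import Mathlib

open scoped Classical
open Finset

/-- Nodes: `{0, 1, …, N}` with root `0`. -/
abbrev V (N : ℕ) := Fin (N + 1)

/-- Directed edges as ordered pairs of nodes. -/
abbrev Edge (N : ℕ) := V N × V N

/-- `(i, j)` is an edge iff `j` is not the root and `i ≠ j`. -/
def IsEdge (N : ℕ) (e : Edge N) : Prop := e.2 ≠ 0 ∧ e.1 ≠ e.2

/-- The finite set `E` of all edges. -/
noncomputable def Efin (N : ℕ) : Finset (Edge N) :=
  Finset.univ.filter (IsEdge N)

/-- A spanning arborescence: a set of edges in which every non-root node has exactly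
one incoming edge, and every non-root node is reachable from the root (equivalently,
there are no directed cycles). -/
def IsArbo (N : ℕ) (d : Finset (Edge N)) : Prop :=
  (∀ e ∈ d, IsEdge N e) ∧
  (∀ j : V N, j ≠ 0 → ∃! i : V N, (i, j) ∈ d) ∧
  (∀ j : V N, j ≠ 0 → Relation.ReflTransGen (fun a b : V N => (a, b) ∈ d) 0 j)

/-- The finite set `D` of all spanning arborescences. -/
noncomputable def D (N : ℕ) : Finset (Finset (Edge N)) :=
  Finset.univ.filter (IsArbo N)

/-- The weight of a tree: product of its edge weights. -/
noncomputable def wt (N : ℕ) (w : Edge N → ℝ) (d : Finset (Edge N)) : ℝ :=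
  ∏ e ∈ d, w e

/-- The partition function `Z`. -/
noncomputable def Z (N : ℕ) (w : Edge N → ℝ) : ℝ :=
  ∑ d ∈ D N, wt N w d

/-- Total weight of arborescences containing the edge `e`. -/
noncomputable def wbar (N : ℕ) (w : Edge N → ℝ) (e : Edge N) : ℝ :=
  ∑ d ∈ (D N).filter (fun d => e ∈ d), wt N w d

/-- The Laplacian matrix, indexed by the non-root nodes `{1, …, N}`
(index `k : Fin N` stands for the node `k.succ`). -/
noncomputable def Lap (N : ℕ) (w : Edge N → ℝ) : Matrix (Fin N) (Fin N) ℝ :=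
  Matrix.of fun i j =>
    if i = j then ∑ i' : V N, (if i' ≠ j.succ then w (i', j.succ) else 0)
    else - w (i.succ, j.succ)

open Matrix

/-- The partition function as the determinant of the Laplacian. -/
noncomputable def Zdet (N : ℕ) (w : Edge N → ℝ) : ℝ := (Lap N w).det

/-- The constant partial derivative `L'_{(i',j'),(a,b)} = ∂L_{i'j'}/∂w_{ab}` of the
(linear-in-`w`) Laplacian entries with respect to an edge weight. -/
def LapD (N : ℕ) (i' j' : Fin N) (e : Edge N) : ℝ :=
  if i' = j' then (if e.2 = j'.succ ∧ e.1 ≠ j'.succ then 1 else 0)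
  else (if e.1 = i'.succ ∧ e.2 = j'.succ then -1 else 0)

/-- `r̂_{j'l'} = Σ_{e∈E} Σ_{k'} B_{k'j'} L'_{(k',l'),e} w_e r_e`. -/
noncomputable def rhat (N R : ℕ) (w : Edge N → ℝ) (r : Edge N → Fin R → ℝ)
    (j' l' : Fin N) : Fin R → ℝ :=
  ∑ e ∈ Efin N, ∑ k' : Fin N, (((Lap N w)⁻¹)ᵀ k' j' * LapD N k' l' e * w e) • r e

/-- `ŝ_{j'l'} = Σ_{e∈E} Σ_{i'} B_{i'l'} L'_{(i',j'),e} w_e s_e`. -/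
noncomputable def shat (N S : ℕ) (w : Edge N → ℝ) (s : Edge N → Fin S → ℝ)
    (j' l' : Fin N) : Fin S → ℝ :=
  ∑ e ∈ Efin N, ∑ i' : Fin N, (((Lap N w)⁻¹)ᵀ i' l' * LapD N i' j' e * w e) • s e

/-- Jacobi's formula for a differentiable curve of matrices. -/
theorem hasDerivAt_det {n : Type*} [Fintype n] [DecidableEq n] {A : ℝ → Matrix n n ℝ}
    {A' : Matrix n n ℝ} {t : ℝ} (h : ∀ i j, HasDerivAt (fun u => A u i j) (A' i j) t) :
    HasDerivAt (fun u => (A u).det) (trace (adjugate (A t) * A')) t := by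
  have key : trace (adjugate (A t) * A') =
      ∑ σ : Equiv.Perm n, ((Equiv.Perm.sign σ : ℤ) : ℝ) *
        ∑ i, (∏ j ∈ Finset.univ.erase i, A t (σ j) j) • A' (σ i) i := by
    have h1 : trace (adjugate (A t) * A') =
        ∑ i, ((A t).updateCol i (fun k => A' k i)).det := by
      refine Finset.sum_congr rfl fun i _ => ?_
      rw [← cramer_apply, cramer_eq_adjugate_mulVec]
      rfl
    simp_rw [h1, det_apply', Finset.mul_sum]
    rw [Finset.sum_comm]
    refine Finset.sum_congr rfl fun σ _ => Finset.sum_congr rfl fun i _ => ?_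
    congr 1
    rw [← Finset.mul_prod_erase _ _ (Finset.mem_univ i), smul_eq_mul, mul_comm]
    congr 1
    · refine Finset.prod_congr rfl fun j hj => ?_
      rw [updateCol_ne (Finset.ne_of_mem_erase hj)]
    · simp
  rw [key]
  simp_rw [det_apply']
  refine HasDerivAt.fun_sum fun σ _ => HasDerivAt.const_mul _ ?_
  exact HasDerivAt.fun_finsetProd fun i _ => h (σ i) i

/-- The derivative of the adjugate along a curve, paired with a fixed matrix, at a point where
the curve is invertible. -/
theorem hasDerivAt_trace_adjugate_mul {n : Type*} [Fintype n] [DecidableEq n]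
    {A : ℝ → Matrix n n ℝ} {A' : Matrix n n ℝ} {t : ℝ}
    (h : ∀ i j, HasDerivAt (fun u => A u i j) (A' i j) t) (hA : IsUnit (A t).det)
    (Y : Matrix n n ℝ) :
    HasDerivAt (fun u => trace (adjugate (A u) * Y))
      ((A t).det * (trace ((A t)⁻¹ * A') * trace ((A t)⁻¹ * Y)
        - trace ((A t)⁻¹ * A' * ((A t)⁻¹ * Y)))) t := by
  have hadj : ∀ i j, ∃ c, HasDerivAt (fun u => adjugate (A u) i j) c t := by
    intro i j
    simp_rw [adjugate_apply]
    refine ⟨_, hasDerivAt_det (A' := A'.updateRow j 0) fun k l => ?_⟩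
    by_cases hk : k = j
    · subst hk
      simpa using hasDerivAt_const t ((Pi.single i 1 : n → ℝ) l)
    · simpa [updateRow_ne hk] using h k l
  choose C hC using hadj
  have hadjugate : adjugate (A t) = (A t).det • (A t)⁻¹ := by
    rw [Matrix.inv_def, smul_smul, Ring.mul_inverse_cancel _ hA, one_smul]
  have hprod : of C * A t + adjugate (A t) * A' = trace (adjugate (A t) * A') • 1 := by
    ext i k
    have h1 : HasDerivAt (fun u => ∑ j, adjugate (A u) i j * A u j k)
        (∑ j, (C i j * A t j k + adjugate (A t) i j * A' j k)) t :=
      HasDerivAt.fun_sum fun j _ => (hC i j).mul (h j k)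
    have h2 : HasDerivAt (fun u => ∑ j, adjugate (A u) i j * A u j k)
        (trace (adjugate (A t) * A') * (1 : Matrix n n ℝ) i k) t := by
      have : (fun u => ∑ j, adjugate (A u) i j * A u j k) =
          fun u => (A u).det * (1 : Matrix n n ℝ) i k := by
        funext u
        have := congrFun (congrFun (adjugate_mul (A u)) i) k
        simpa [Matrix.mul_apply] using this
      rw [this]
      exact (hasDerivAt_det h).mul_const _
    have := h1.unique h2
    rw [Finset.sum_add_distrib] at this
    simpa [Matrix.mul_apply] using this
  have hCeq : of C = (A t).det • (trace ((A t)⁻¹ * A') • (A t)⁻¹ - (A t)⁻¹ * A' * (A t)⁻¹) := by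
    have h3 : of C * A t = trace (adjugate (A t) * A') • 1 - adjugate (A t) * A' :=
      eq_sub_of_add_eq hprod
    have h4 : of C = of C * A t * (A t)⁻¹ := by
      rw [Matrix.mul_assoc, mul_nonsing_inv _ hA, Matrix.mul_one]
    rw [h4, h3, hadjugate]
    simp [Matrix.sub_mul, smul_sub, smul_smul, trace_smul]
  have hval : (A t).det * (trace ((A t)⁻¹ * A') * trace ((A t)⁻¹ * Y)
        - trace ((A t)⁻¹ * A' * ((A t)⁻¹ * Y))) = trace (of C * Y) := by
    rw [hCeq]
    simp [Matrix.sub_mul, trace_smul, trace_sub, Matrix.mul_assoc]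
  rw [hval]
  simp only [trace, Matrix.diag, Matrix.mul_apply]
  exact HasDerivAt.fun_sum fun i _ => HasDerivAt.fun_sum fun j _ => (hC i j).mul_const _

/-- The partial derivative of the Laplacian in the coordinate `e`, as a matrix. -/
def lapDeriv (N : ℕ) (e : Edge N) : Matrix (Fin N) (Fin N) ℝ := of fun i j => LapD N i j e

theorem lap_add_smul_single (N : ℕ) (w : Edge N → ℝ) (e : Edge N) (t : ℝ) :
    Lap N (w + t • Pi.single e 1) = Lap N w + t • lapDeriv N e := by
  obtain ⟨a, b⟩ := e
  ext i j
  by_cases hij : i = j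
  · subst hij
    have hs : ∀ x : V N, (if x ≠ i.succ then
          (w + t • (Pi.single (a, b) 1 : Edge N → ℝ)) (x, i.succ) else 0) =
        (if x ≠ i.succ then w (x, i.succ) else 0) +
          if x = a then (if b = i.succ ∧ a ≠ i.succ then t else 0) else 0 := by
      intro x
      simp only [Pi.add_apply, Pi.smul_apply, Pi.single_apply, Prod.mk.injEq, smul_eq_mul]
      grind
    simp only [Lap, lapDeriv, LapD, of_apply, Matrix.add_apply, Matrix.smul_apply, if_true, hs,
      Finset.sum_add_distrib, Finset.sum_ite_eq', Finset.mem_univ]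
    simp
  · simp only [Lap, lapDeriv, LapD, of_apply, Matrix.add_apply, Matrix.smul_apply, hij, if_false,
      Pi.add_apply, Pi.smul_apply, Pi.single_apply, Prod.mk.injEq, smul_eq_mul]
    grind

theorem hasDerivAt_lap_line (N : ℕ) (w : Edge N → ℝ) (e : Edge N) (i j : Fin N) (t : ℝ) :
    HasDerivAt (fun u : ℝ => Lap N (w + u • Pi.single e 1) i j) (lapDeriv N e i j) t := by
  simp_rw [lap_add_smul_single, Matrix.add_apply, Matrix.smul_apply, smul_eq_mul]
  simpa using ((hasDerivAt_id t).mul_const (lapDeriv N e i j)).const_add (Lap N w i j)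

theorem contDiff_Zdet (N : ℕ) : ContDiff ℝ 2 (Zdet N) := by
  unfold Zdet
  simp_rw [det_apply']
  refine ContDiff.sum fun σ _ => contDiff_const.mul (contDiff_prod fun i _ => ?_)
  simp only [Lap, of_apply]
  split_ifs
  · refine ContDiff.sum fun a _ => ?_
    split_ifs <;> fun_prop
  · fun_prop

theorem fderiv_Zdet_single (N : ℕ) (w : Edge N → ℝ) (e : Edge N) :
    fderiv ℝ (Zdet N) w (Pi.single e 1) = trace (adjugate (Lap N w) * lapDeriv N e) := by
  have h1 := (((contDiff_Zdet N).differentiable (by norm_num)) w).hasFDerivAt.hasLineDerivAt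
    (Pi.single e 1)
  have h2 := hasDerivAt_det (fun i j => hasDerivAt_lap_line N w e i j 0)
  simp only [zero_smul, add_zero] at h2
  exact HasDerivAt.unique h1 h2

theorem fderiv_fderiv_Zdet_single (N : ℕ) (w : Edge N → ℝ) (hL : IsUnit (Lap N w).det)
    (e e' : Edge N) :
    fderiv ℝ (fun w' => fderiv ℝ (Zdet N) w' (Pi.single e' 1)) w (Pi.single e 1) =
      Zdet N w * (trace ((Lap N w)⁻¹ * lapDeriv N e) * trace ((Lap N w)⁻¹ * lapDeriv N e')
        - trace ((Lap N w)⁻¹ * lapDeriv N e * ((Lap N w)⁻¹ * lapDeriv N e'))) := by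
  have hd : DifferentiableAt ℝ (fun w' => fderiv ℝ (Zdet N) w' (Pi.single e' 1)) w := by
    have : Differentiable ℝ (fderiv ℝ (Zdet N)) :=
      ((contDiff_Zdet N).fderiv_right (m := 1) (by norm_num)).differentiable (by norm_num)
    exact (this w).clm_apply (differentiableAt_const _)
  have h1 := hd.hasFDerivAt.hasLineDerivAt (Pi.single e 1)
  have h2 := hasDerivAt_trace_adjugate_mul (fun i j => hasDerivAt_lap_line N w e i j 0)
    (by simpa using hL) (lapDeriv N e')
  simp only [zero_smul, add_zero] at h2
  refine HasDerivAt.unique h1 ?_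
  simp_rw [fderiv_Zdet_single]
  exact h2

/-- The self-map of the nodes sending a non-root node to its chosen parent and fixing the root. -/
def parentMap {N : ℕ} (f : Fin N → V N) : V N → V N := Fin.cons 0 f

/-- Following parents from any node eventually reaches the root. -/
def ReachesRoot {N : ℕ} (f : Fin N → V N) : Prop := ∀ v, ∃ n, (parentMap f)^[n] v = 0

/-- The set of edges determined by a choice of parents. -/
noncomputable def parentEdges {N : ℕ} (f : Fin N → V N) : Finset (Edge N) :=
  Finset.univ.image fun j => (f j, j.succ)

@[simp] theorem parentMap_zero {N : ℕ} (f : Fin N → V N) : parentMap f 0 = 0 := rfl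

@[simp] theorem parentMap_succ {N : ℕ} (f : Fin N → V N) (j : Fin N) :
    parentMap f j.succ = f j := by simp [parentMap]

theorem mk_succ_mem_parentEdges {N : ℕ} {f : Fin N → V N} {a : V N} {j : Fin N} :
    (a, j.succ) ∈ parentEdges f ↔ f j = a := by
  simp [parentEdges]

theorem mk_zero_notMem_parentEdges {N : ℕ} {f : Fin N → V N} {a : V N} :
    (a, 0) ∉ parentEdges f := by
  simp [parentEdges, Fin.succ_ne_zero]

theorem parentEdges_injective (N : ℕ) : Function.Injective (parentEdges (N := N)) := by
  intro f g h
  funext j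
  have : (g j, j.succ) ∈ parentEdges f := h ▸ mk_succ_mem_parentEdges.2 rfl
  exact mk_succ_mem_parentEdges.1 this

theorem wt_parentEdges {N : ℕ} (w : Edge N → ℝ) (f : Fin N → V N) :
    wt N w (parentEdges f) = ∏ j, w (f j, j.succ) := by
  unfold wt parentEdges
  rw [Finset.prod_image]
  intro i _ j _ h
  simpa using congrArg Prod.snd h

theorem ReachesRoot.parent_ne {N : ℕ} {f : Fin N → V N} (hf : ReachesRoot f) (j : Fin N) :
    f j ≠ j.succ := by
  intro h
  obtain ⟨n, hn⟩ := hf j.succ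
  rw [Function.iterate_fixed (by simpa using h)] at hn
  exact Fin.succ_ne_zero j hn

theorem isArbo_parentEdges {N : ℕ} (f : Fin N → V N) :
    IsArbo N (parentEdges f) ↔ ReachesRoot f := by
  constructor
  · rintro ⟨-, -, h⟩ v
    have key : ∀ v, Relation.ReflTransGen (fun a b : V N => (a, b) ∈ parentEdges f) 0 v →
        ∃ n, (parentMap f)^[n] v = 0 := by
      intro v hv
      induction hv with
      | refl => exact ⟨0, rfl⟩
      | @tail b c _ hbc ih =>
        obtain ⟨n, hn⟩ := ih
        refine ⟨n + 1, ?_⟩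
        rw [Function.iterate_succ_apply]
        cases c using Fin.cases with
        | zero => exact absurd hbc mk_zero_notMem_parentEdges
        | succ j => rw [parentMap_succ, mk_succ_mem_parentEdges.1 hbc, hn]
    by_cases hv : v = 0
    · exact ⟨0, hv⟩
    · exact key v (h v hv)
  · intro hf
    refine ⟨?_, ?_, ?_⟩
    · intro e he
      obtain ⟨j, -, rfl⟩ := Finset.mem_image.1 he
      exact ⟨Fin.succ_ne_zero j, hf.parent_ne j⟩
    · intro v hv
      obtain ⟨j, rfl⟩ := Fin.exists_succ_eq.2 hv
      exact ⟨f j, mk_succ_mem_parentEdges.2 rfl, fun a ha => (mk_succ_mem_parentEdges.1 ha).symm⟩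
    · intro v _
      obtain ⟨n, hn⟩ := hf v
      induction n generalizing v with
      | zero => exact (show v = 0 from hn) ▸ Relation.ReflTransGen.refl
      | succ n ih =>
        rw [Function.iterate_succ_apply] at hn
        cases v using Fin.cases with
        | zero => exact Relation.ReflTransGen.refl
        | succ j =>
          rw [parentMap_succ] at hn
          by_cases h0 : f j = 0
          · exact .single (mk_succ_mem_parentEdges.2 h0)
          · exact (ih (f j) h0 hn).tail (mk_succ_mem_parentEdges.2 rfl)

theorem IsArbo.exists_parentEdges {N : ℕ} {d : Finset (Edge N)} (hd : IsArbo N d) :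
    ∃ f, parentEdges f = d := by
  choose f hf hu using fun j : Fin N => hd.2.1 j.succ (Fin.succ_ne_zero j)
  refine ⟨f, ?_⟩
  ext ⟨a, b⟩
  cases b using Fin.cases with
  | zero => exact ⟨fun h => absurd h mk_zero_notMem_parentEdges, fun h => absurd rfl (hd.1 _ h).1⟩
  | succ j =>
    rw [mk_succ_mem_parentEdges]
    exact ⟨fun h => h ▸ hf j, fun h => (hu j a h).symm⟩

theorem D_eq_image (N : ℕ) :
    D N = (Finset.univ.filter (ReachesRoot (N := N))).image parentEdges := by
  ext d
  simp only [D, Finset.mem_filter, Finset.mem_univ, true_and, Finset.mem_image]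
  constructor
  · intro hd
    obtain ⟨f, rfl⟩ := hd.exists_parentEdges
    exact ⟨f, (isArbo_parentEdges f).1 hd, rfl⟩
  · rintro ⟨f, hf, rfl⟩
    exact (isArbo_parentEdges f).2 hf

theorem Z_eq_sum_parents (N : ℕ) (w : Edge N → ℝ) :
    Z N w = ∑ f : Fin N → V N, if ReachesRoot f then ∏ j, w (f j, j.succ) else 0 := by
  rw [Z, D_eq_image, Finset.sum_image (fun _ _ _ _ h => parentEdges_injective N h),
    Finset.sum_filter]
  simp_rw [wt_parentEdges]

/-- The Laplacian of the unweighted graph given by a choice of parents. -/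
def parentLap {N : ℕ} (f : Fin N → V N) : Matrix (Fin N) (Fin N) ℝ :=
  of fun i j => (if i = j then 1 else 0) - (if f j = i.succ then 1 else 0)

theorem det_parentLap {N : ℕ} (f : Fin N → V N) :
    (parentLap f).det = if ReachesRoot f then 1 else 0 := by
  split_ifs with hf
  · have hdepth : ∀ i j : Fin N, f j = i.succ →
        Nat.find (hf i.succ) < Nat.find (hf j.succ) := by
      intro i j hij
      have hspec := Nat.find_spec (hf j.succ)
      cases hm : Nat.find (hf j.succ) with
      | zero =>
        rw [hm] at hspec
        exact absurd hspec (Fin.succ_ne_zero j)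
      | succ m =>
        rw [hm, Function.iterate_succ_apply, parentMap_succ, hij] at hspec
        exact Nat.lt_succ_of_le (Nat.find_min' _ hspec)
    have htri : (parentLap f).BlockTriangular fun i => Nat.find (hf i.succ) := by
      intro i j hlt
      have h1 : i ≠ j := by rintro rfl; exact lt_irrefl _ hlt
      have h2 : f j ≠ i.succ := fun h => lt_asymm hlt (hdepth i j h)
      simp [parentLap, h1, h2]
    rw [htri.det]
    refine Finset.prod_eq_one fun a _ => ?_
    rw [show (parentLap f).toSquareBlock (fun i => Nat.find (hf i.succ)) a = 1 from ?_, det_one]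
    ext ⟨i, hi⟩ ⟨j, hj⟩
    have h2 : f j ≠ i.succ := fun h => absurd (hdepth i j h) (by simp only [hi, hj]; omega)
    simp [parentLap, toSquareBlock, toSquareBlockProp, h2, Matrix.one_apply]
  · unfold ReachesRoot at hf
    push Not at hf
    obtain ⟨v, hv⟩ := hf
    let P : V N → Prop := fun x => ∀ n, (parentMap f)^[n] x ≠ 0
    have hP0 : ¬ P 0 := fun h => h 0 rfl
    have hP : ∀ j : Fin N, P (f j) ↔ P j.succ := by
      intro j
      constructor
      · intro h n
        cases n with
        | zero => exact Fin.succ_ne_zero j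
        | succ n => rw [Function.iterate_succ_apply, parentMap_succ]; exact h n
      · intro h n
        have := h (n + 1)
        rwa [Function.iterate_succ_apply, parentMap_succ] at this
    obtain ⟨j₀, rfl⟩ : ∃ j : Fin N, j.succ = v := Fin.exists_succ_eq.2 (hv 0)
    refine exists_vecMul_eq_zero_iff.1 ⟨fun i => if P i.succ then 1 else 0, ?_, ?_⟩
    · intro h
      have := congrFun h j₀
      simp only [Pi.zero_apply, ite_eq_right_iff, one_ne_zero, imp_false] at this
      exact this hv
    · funext j
      have hsum : ∑ i : Fin N, (if P i.succ then (1 : ℝ) else 0) * (if f j = i.succ then 1 else 0)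
          = if P (f j) then 1 else 0 := by
        cases hfj : f j using Fin.cases with
        | zero =>
          simp only [hP0, if_false]
          exact Finset.sum_eq_zero fun i _ => by simp [(Fin.succ_ne_zero i).symm]
        | succ k => simp
      simp only [vecMul, dotProduct, parentLap, of_apply, mul_sub, Finset.sum_sub_distrib, hsum,
        hP j, Pi.zero_apply]
      simp

theorem lap_transpose_apply (N : ℕ) (w : Edge N → ℝ) (j : Fin N) :
    (Lap N w)ᵀ j = ∑ a : V N, w (a, j.succ) •
      fun i : Fin N => ((if i = j then 1 else 0) - (if a = i.succ then 1 else 0) : ℝ) := by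
  funext i
  simp only [transpose_apply, Lap, of_apply, Finset.sum_apply, Pi.smul_apply, smul_eq_mul]
  by_cases hij : i = j
  · subst hij
    rw [if_pos rfl]
    exact Finset.sum_congr rfl fun a _ => by split_ifs <;> simp_all
  · simp [hij]

/-- The directed matrix-tree theorem. -/
theorem Zdet_eq_Z (N : ℕ) (w : Edge N → ℝ) : Zdet N w = Z N w := by
  have h : Zdet N w = (detRowAlternating : (Fin N → ℝ) [⋀^Fin N]→ₗ[ℝ] ℝ).toMultilinearMap
      (fun j => ∑ a : V N, w (a, j.succ) •
        fun i : Fin N => ((if i = j then 1 else 0) - (if a = i.succ then 1 else 0) : ℝ)) := by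
    rw [Zdet, ← det_transpose]
    exact congrArg _ (funext fun j => lap_transpose_apply N w j)
  rw [h, MultilinearMap.map_sum, Z_eq_sum_parents]
  refine Finset.sum_congr rfl fun f _ => ?_
  rw [MultilinearMap.map_smul_univ]
  have : (detRowAlternating : (Fin N → ℝ) [⋀^Fin N]→ₗ[ℝ] ℝ).toMultilinearMap
      (fun j => fun i : Fin N => ((if i = j then 1 else 0) - (if f j = i.succ then 1 else 0) : ℝ))
      = (parentLap f).det := by
    rw [← det_transpose]
    rfl
  rw [this, det_parentLap]
  simp

theorem wbar_eq_trace (N : ℕ) (w : Edge N → ℝ) {e : Edge N} (he : e ∈ Efin N) :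
    wbar N w e = w e * trace (adjugate (Lap N w) * lapDeriv N e) := by
  obtain ⟨a, b⟩ := e
  obtain ⟨hb, hab⟩ : b ≠ 0 ∧ a ≠ b := (Finset.mem_filter.1 he).2
  obtain ⟨j, rfl⟩ := Fin.exists_succ_eq.2 hb
  let w' : Edge N → ℝ := fun x => if x.2 = j.succ ∧ x.1 ≠ a then 0 else w x
  have hw : wbar N w (a, j.succ) = Z N w' := by
    rw [wbar, Finset.sum_filter]
    refine Finset.sum_congr rfl fun d hd => ?_
    obtain ⟨-, hd, -⟩ : IsArbo N d := (Finset.mem_filter.1 hd).2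
    obtain ⟨p, hp, hu⟩ := hd j.succ (Fin.succ_ne_zero j)
    split_ifs with h
    · refine Finset.prod_congr rfl fun x hx => (if_neg ?_).symm
      rintro ⟨h2, h1⟩
      obtain ⟨x1, x2⟩ := x
      dsimp only at h1 h2
      subst h2
      exact h1 ((hu _ hx).trans (hu _ h).symm)
    · have hpa : p ≠ a := by
        rintro rfl
        exact h hp
      have hp0 : w' (p, j.succ) = 0 := if_pos ⟨rfl, hpa⟩
      exact (Finset.prod_eq_zero hp hp0).symm
  have hlap : Lap N w' =
      (Lap N w).updateCol j (w (a, j.succ) • fun i => lapDeriv N (a, j.succ) i j) := by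
    ext i k
    by_cases hk : k = j
    · subst hk
      rw [updateCol_self]
      by_cases hik : i = k
      · subst hik
        have hs : ∀ x : V N, (if x ≠ i.succ then w' (x, i.succ) else 0) =
            if x = a then w (a, i.succ) else 0 := by
          intro x
          simp only [w']
          grind
        simp only [Lap, of_apply, if_true, hs, Finset.sum_ite_eq', Finset.mem_univ, Pi.smul_apply,
          lapDeriv, LapD, smul_eq_mul]
        simp [hab]
      · simp only [Lap, of_apply, hik, if_false, w', Pi.smul_apply, lapDeriv, LapD, smul_eq_mul]
        grind
    · rw [updateCol_ne hk]
      simp [Lap, w', hk]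
  have htr : trace (adjugate (Lap N w) * lapDeriv N (a, j.succ)) =
      cramer (Lap N w) (fun i => lapDeriv N (a, j.succ) i j) j := by
    rw [cramer_eq_adjugate_mulVec, trace, Finset.sum_eq_single j]
    · rfl
    · intro k _ hk
      rw [Matrix.diag_apply, Matrix.mul_apply]
      refine Finset.sum_eq_zero fun i _ => ?_
      simp [lapDeriv, LapD, Ne.symm hk]
    · simp
  rw [hw, ← Zdet_eq_Z, Zdet, hlap, det_updateCol_smul, htr, cramer_apply]

theorem rhat_apply (N R : ℕ) (w : Edge N → ℝ) (r : Edge N → Fin R → ℝ) (j l : Fin N)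
    (x : Fin R) : rhat N R w r j l x =
      ∑ e ∈ Efin N, ((Lap N w)⁻¹ * lapDeriv N e) j l * w e * r e x := by
  simp only [rhat, Finset.sum_apply, Pi.smul_apply, smul_eq_mul, Matrix.mul_apply, Finset.sum_mul]
  rfl

theorem shat_eq_rhat (N S : ℕ) (w : Edge N → ℝ) (s : Edge N → Fin S → ℝ) (j l : Fin N) :
    shat N S w s j l = rhat N S w s l j := rfl

/-- **Factored second-order decomposition** (Appendix B, Eq. tbar-eff cross term):
`Σ_{e,e'∈E} (∂²Z/∂w_e∂w_{e'}) w_e w_{e'} r_e s_{e'}^⊤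
  = (1/Z) r̄ s̄^⊤ − Z Σ_{j',l'} r̂_{j'l'} ŝ_{j'l'}^⊤`,
where `r̄ = Σ_e w̄_e(w) r_e` and `s̄ = Σ_e w̄_e(w) s_e`. -/
theorem factored_second_order (N : ℕ) (hN : 1 ≤ N) (R S : ℕ)
    (r : Edge N → Fin R → ℝ) (s : Edge N → Fin S → ℝ) (w : Edge N → ℝ)
    (hL : IsUnit (Lap N w).det) :
    (∑ e ∈ Efin N, ∑ e' ∈ Efin N,
        (fderiv ℝ (fun w' => fderiv ℝ (Zdet N) w' (Pi.single e' 1)) w (Pi.single e 1)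
            * w e * w e') • Matrix.vecMulVec (r e) (s e'))
      = (1 / Zdet N w) • Matrix.vecMulVec
            (∑ e ∈ Efin N, wbar N w e • r e) (∑ e ∈ Efin N, wbar N w e • s e)
        - Zdet N w • ∑ j' : Fin N, ∑ l' : Fin N,
            Matrix.vecMulVec (rhat N R w r j' l') (shat N S w s j' l') := by
  have hdet : Zdet N w ≠ 0 := hL.ne_zero
  have hwbar : ∀ e ∈ Efin N,
      wbar N w e = Zdet N w * (w e * trace ((Lap N w)⁻¹ * lapDeriv N e)) := by
    intro e he
    have hadj : adjugate (Lap N w) = Zdet N w • (Lap N w)⁻¹ := by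
      rw [Matrix.inv_def, smul_smul, Zdet, Ring.mul_inverse_cancel _ hL, one_smul]
    rw [wbar_eq_trace N w he, hadj, smul_mul, trace_smul, smul_eq_mul]
    ring
  have hcross : ∀ x y, ∑ j, ∑ l, rhat N R w r j l x * shat N S w s j l y =
      ∑ e ∈ Efin N, ∑ e' ∈ Efin N,
        trace ((Lap N w)⁻¹ * lapDeriv N e * ((Lap N w)⁻¹ * lapDeriv N e')) *
          (w e * w e' * (r e x * s e' y)) := by
    intro x y
    simp_rw [shat_eq_rhat, rhat_apply, Finset.sum_mul_sum]
    simp_rw [Finset.sum_comm (s := Finset.univ) (t := Efin N)]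
    refine Finset.sum_congr rfl fun e _ => Finset.sum_congr rfl fun e' _ => ?_
    rw [trace, Finset.sum_mul]
    refine Finset.sum_congr rfl fun j _ => ?_
    rw [Matrix.diag_apply, Matrix.mul_apply, Finset.sum_mul]
    exact Finset.sum_congr rfl fun l _ => by ring
  ext x y
  simp only [Matrix.sum_apply, Matrix.sub_apply, Matrix.smul_apply, vecMulVec_apply, smul_eq_mul,
    Finset.sum_apply, Pi.smul_apply, hcross]
  rw [Finset.sum_mul_sum, Finset.mul_sum, Finset.mul_sum, ← Finset.sum_sub_distrib]
  refine Finset.sum_congr rfl fun e he => ?_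
  rw [Finset.mul_sum, Finset.mul_sum, ← Finset.sum_sub_distrib]
  refine Finset.sum_congr rfl fun e' he' => ?_
  rw [fderiv_fderiv_Zdet_single N w hL, hwbar e he, hwbar e' he']
  field_simp
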